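/- Let d be a positive square-free integer with d ≡ 3 (mod 4), K = ℚ(√−d), R = 𝓞_K, and let m, p be rational integers. The element u = m√−d + p·i + (1−p)·j ∈ ℍ(R) is a unit of ℍ(R) if and only if ε = (2p−1) + m√(2d) is a unit of the ring ℤ[√(2d)] (the ring of integers of 𝔽 = ℚ(√(2d))), i.e., if and only if (2p−1)² − 2d m² = ±1. -/

import Mathlib

open Quaternion NumberField

/-- A quaternion over a commutative ring is a unit iff its norm is. -/
lemma Quaternion.isUnit_iff_isUnit_normSq {R : Type*} [CommRing R] (a : ℍ[R]) :
    IsUnit a ↔ IsUnit (Quaternion.normSq a) := by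
  refine ⟨fun h => h.map Quaternion.normSq, fun h => ?_⟩
  obtain ⟨c, hc⟩ := h.exists_right_inv
  have hc' : ((normSq a : R) : ℍ[R]) * (c : ℍ[R]) = 1 := by
    rw [← Quaternion.coe_mul, hc, Quaternion.coe_one]
  have hright : a * (star a * (c : ℍ[R])) = 1 := by
    rw [← mul_assoc, Quaternion.self_mul_star, hc']
  have hleft : (star a * (c : ℍ[R])) * a = 1 := by
    rw [mul_assoc, Quaternion.coe_commutes, ← mul_assoc, Quaternion.star_mul_self, hc']
  exact ⟨⟨a, _, hright, hleft⟩, rfl⟩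

/-- A rational integer is a unit in a ring of integers iff it is a unit in `ℤ`. -/
lemma NumberField.RingOfIntegers.isUnit_intCast_iff {K : Type*} [Field K] [NumberField K]
    (n : ℤ) : IsUnit (n : 𝓞 K) ↔ IsUnit n := by
  refine ⟨fun h => ?_, fun h => by simpa using h.map (Int.castRingHom (𝓞 K))⟩
  have hnorm := h.map (Algebra.norm ℤ)
  rw [← eq_intCast (algebraMap ℤ (𝓞 K)), Algebra.norm_algebraMap] at hnorm
  refine (isUnit_pow_iff ?_).mp hnorm
  exact Module.finrank_pos.ne'

/-- The negative Pell equation `x² − 2d·m² = −1` has no solution for `d ≡ 3 (mod 4)`. -/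
lemma sq_sub_two_mul_sq_ne_neg_one {d : ℤ} (hd : 0 < d) (hd4 : d % 4 = 3) (x m : ℤ) :
    x ^ 2 - 2 * d * m ^ 2 ≠ -1 := by
  intro h
  lift d to ℕ using hd.le
  have hsq : IsSquare (-1 : ZMod d) := by
    refine ⟨(x : ZMod d), ?_⟩
    have := congrArg (Int.cast : ℤ → ZMod d) h
    push_cast at this
    rw [ZMod.natCast_self] at this
    linear_combination -this
  obtain ⟨a, b, hab⟩ := Nat.eq_sq_add_sq_of_isSquare_mod_neg_one hsq
  have ha := Nat.pow_mod a 2 4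
  have hb := Nat.pow_mod b 2 4
  have := Nat.mod_lt a (show 4 > 0 by norm_num)
  have := Nat.mod_lt b (show 4 > 0 by norm_num)
  interval_cases a % 4 <;> interval_cases b % 4 <;> omega

/-- For odd `x`, the form `x² − 2d·m²` does not take the value `−3` when `d` is odd. -/
lemma odd_sq_sub_two_mul_sq_ne_neg_three {d x : ℤ} (hd : Odd d) (hx : Odd x) (m : ℤ) :
    x ^ 2 - 2 * d * m ^ 2 ≠ -3 := by
  intro h
  have hx8 := Int.eight_dvd_sq_sub_one_of_odd hx
  obtain ⟨k, rfl⟩ := hd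
  rcases Int.even_or_odd' m with ⟨c, rfl | rfl⟩
  · have : 2 * (2 * k + 1) * (2 * c) ^ 2 = 8 * ((2 * k + 1) * c ^ 2) := by ring
    omega
  · have : 2 * (2 * k + 1) * (2 * c + 1) ^ 2 =
        4 * ((2 * k + 1) * (2 * c ^ 2 + 2 * c) + k) + 2 := by ring
    omega

/-- Let `d > 0` be square-free with `d ≡ 3 (mod 4)`, `K = ℚ(√−d)`,
`R = 𝓞 K`, and let `m, p` be rational integers. The element
`u = m√−d + p·i + (1−p)·j ∈ ℍ(R)` is a unit of `ℍ(R)` iff `ε = (2p−1) + m√(2d)` is a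
unit of `ℤ[√(2d)]`, i.e. iff `(2p−1)² − 2d·m² = ±1`. -/
theorem quaternion_pell_unit_iff_2d
    (d : ℤ) (hd : 0 < d) (hsf : Squarefree d) (hd4 : d % 4 = 3)
    (K : Type) [Field K] [NumberField K]
    (rd : 𝓞 K) (hrd : rd ^ 2 = -(d : 𝓞 K))
    (hgen : Algebra.adjoin ℚ {(rd : K)} = ⊤)
    (m p : ℤ) :
    (IsUnit (⟨(m : 𝓞 K) * rd, (p : 𝓞 K), ((1 - p : ℤ) : 𝓞 K), 0⟩ : ℍ[𝓞 K]) ↔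
        IsUnit (⟨2 * p - 1, m⟩ : ℤ√(2 * d))) ∧
      (IsUnit (⟨(m : 𝓞 K) * rd, (p : 𝓞 K), ((1 - p : ℤ) : 𝓞 K), 0⟩ : ℍ[𝓞 K]) ↔
        (2 * p - 1) ^ 2 - 2 * d * m ^ 2 = 1 ∨ (2 * p - 1) ^ 2 - 2 * d * m ^ 2 = -1) := by
  have hnormSq : Quaternion.normSq
      (⟨(m : 𝓞 K) * rd, (p : 𝓞 K), ((1 - p : ℤ) : 𝓞 K), 0⟩ : ℍ[𝓞 K]) =
      ((p ^ 2 + (1 - p) ^ 2 - d * m ^ 2 : ℤ) : 𝓞 K) := by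
    refine (Quaternion.normSq_def' _).trans ?_
    push_cast
    linear_combination (m : 𝓞 K) ^ 2 * hrd
  have hneg_one := sq_sub_two_mul_sq_ne_neg_one hd hd4 (2 * p - 1) m
  have hneg_three := odd_sq_sub_two_mul_sq_ne_neg_three (d := d) (x := 2 * p - 1)
    (Int.odd_iff.mpr (by omega)) (Int.odd_iff.mpr (by omega)) m
  have hpell : IsUnit (⟨(m : 𝓞 K) * rd, (p : 𝓞 K), ((1 - p : ℤ) : 𝓞 K), 0⟩ : ℍ[𝓞 K]) ↔
      (2 * p - 1) ^ 2 - 2 * d * m ^ 2 = 1 ∨ (2 * p - 1) ^ 2 - 2 * d * m ^ 2 = -1 := by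
    refine (Quaternion.isUnit_iff_isUnit_normSq _).trans ?_
    rw [congrArg IsUnit hnormSq,
      NumberField.RingOfIntegers.isUnit_intCast_iff, Int.isUnit_iff, or_iff_left hneg_one]
    constructor
    · rintro (h | h)
      · linear_combination 2 * h
      · exact absurd (by linear_combination 2 * h) hneg_three
    · intro h
      left
      linarith
  refine ⟨hpell.trans ?_, hpell⟩
  rw [← Zsqrtd.norm_eq_one_iff, Int.natAbs_eq_iff, Zsqrtd.norm_def]
  push_cast
  ring_nf
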